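/- Let p ∈ ℕ₀ and q ∈ ℕ. The transfer operator L : h ↦ h∘Φ extends to a continuous linear operator on B^{p,q}_N whose spectral radius is at most one. Moreover, for N = 0 the spectral radius of L : B^{p,q}_0 → B^{p,q}_0 is exactly equal to 1. -/

import Mathlib

open MeasureTheory Filter Asymptotics

noncomputable section

/-- The Heisenberg group `ℍ`: `ℝ³` with the polarised group law
`(x,y,z) * (x',y',z') = (x+x', y+y', z+z'+x·y')`. -/
abbrev Heis : Type := ℝ × ℝ × ℝ

/-- The group law of the Heisenberg group. -/
def hmul (g g' : Heis) : Heis :=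
  (g.1 + g'.1, g.2.1 + g'.2.1, g.2.2 + g'.2.2 + g.1 * g'.2.1)

/-- The Lie bracket on the Lie algebra `ℝ³` of the Heisenberg group. -/
def hbracket (v w : ℝ × ℝ × ℝ) : ℝ × ℝ × ℝ :=
  (0, 0, v.1 * w.2.1 - w.1 * v.2.1)

/-- The exponential map of the Heisenberg group. -/
def hexp (v : ℝ × ℝ × ℝ) : Heis := (v.1, v.2.1, v.2.2 + v.1 * v.2.1 / 2)

/-- The inverse of the exponential map. -/
def hlog (g : Heis) : ℝ × ℝ × ℝ := (g.1, g.2.1, g.2.2 - g.1 * g.2.1 / 2)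

/-- The basis element `X` of the Lie algebra. -/
def Xvec : ℝ × ℝ × ℝ := (1, 0, 0)

/-- The basis element `Y` of the Lie algebra. -/
def Yvec : ℝ × ℝ × ℝ := (0, 1, 0)

/-- The central element `Z` of the Lie algebra. -/
def Zvec : ℝ × ℝ × ℝ := (0, 0, 1)

/-- The lattice `Γ_K = {(x, y, z/K) : x,y,z ∈ ℤ}`. -/
def GammaK (K : ℕ) : Set Heis :=
  {g | ∃ x y z : ℤ, g = ((x : ℝ), (y : ℝ), (z : ℝ) / K)}

/-- The flow generated by the left-invariant vector field associated to `U`: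
`m ↦ m * exp (t U)`. -/
def hflow (U : ℝ × ℝ × ℝ) (t : ℝ) (m : Heis) : Heis := hmul m (hexp (t • U))

/-- The action of the left-invariant vector field associated to `U` on functions. -/
def VF (U : ℝ × ℝ × ℝ) (h : Heis → ℂ) (m : Heis) : ℂ :=
  deriv (fun t : ℝ => h (hflow U t m)) 0

/-- `C^∞(M)`: smooth `Γ_K`-invariant functions on `ℍ` (functions on `M = Γ_K\ℍ`). -/
def SmoothM (K : ℕ) (h : Heis → ℂ) : Prop :=
  ContDiff ℝ (⊤ : ℕ∞) h ∧ ∀ γ ∈ GammaK K, ∀ m : Heis, h (hmul γ m) = h m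

/-- `C^q(M)`: `C^q` `Γ_K`-invariant functions on `ℍ`. -/
def CqM (K : ℕ) (q : ℕ) (g : Heis → ℂ) : Prop :=
  ContDiff ℝ q g ∧ ∀ γ ∈ GammaK K, ∀ m : Heis, g (hmul γ m) = g m

/-- `C^∞_N = {h ∈ C^∞(M) : Z h = 2πiNK·h}`. -/
def CN (K : ℕ) (N : ℤ) (h : Heis → ℂ) : Prop :=
  SmoothM K h ∧ VF Zvec h = fun m => (2 * Real.pi * Complex.I * N * K) * h m

/-- The `C^r` norm `‖f‖_{C^r} = sup_{k ≤ r} 2^{r-k} sup |f^{(k)}|` of a function on `ℝ`. -/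
def CrNorm (r : ℕ) (η : ℝ → ℂ) : ℝ :=
  ⨆ k : Fin (r + 1), (2 : ℝ) ^ (r - (k : ℕ)) * ⨆ t : ℝ, ‖iteratedDeriv (k : ℕ) η t‖

/-- The `C^r` norm of a function on `M`. -/
def MCrNorm (r : ℕ) (g : Heis → ℂ) : ℝ :=
  ⨆ k : Fin (r + 1), (2 : ℝ) ^ (r - (k : ℕ)) * ⨆ m : Heis, ‖iteratedFDeriv ℝ (k : ℕ) g m‖

/-- Test functions: `C^∞` functions with support compactly contained in `(-δ, δ)`. -/
def TestFun (δ : ℝ) (η : ℝ → ℂ) : Prop :=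
  ContDiff ℝ (⊤ : ℕ∞) η ∧ HasCompactSupport η ∧ tsupport η ⊆ Set.Ioo (-δ) δ

/-- The linear functional `ℓ_{η,m}(h) = ∫_{-δ}^{δ} η(t)·h(φ_t^W(m)) dt`. -/
def ell (Wd : ℝ × ℝ × ℝ) (δ : ℝ) (η : ℝ → ℂ) (m : Heis) (h : Heis → ℂ) : ℂ :=
  ∫ t in (-δ)..δ, η t * h (hflow Wd t m)

/-- The seminorm `|h|_{j,q}`. -/
def semiNorm (Vd Wd : ℝ × ℝ × ℝ) (δ : ℝ) (j q : ℕ) (h : Heis → ℂ) : ℝ :=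
  sSup {x : ℝ | ∃ m : Heis, ∃ η : ℝ → ℂ, TestFun δ η ∧ CrNorm q η ≤ 1 ∧
    x = ‖ell Wd δ η m ((VF Vd)^[j] h)‖}

/-- The anisotropic norm `‖h‖_{p,q}`. -/
def pqNorm (Vd Wd : ℝ × ℝ × ℝ) (δ : ℝ) (p q : ℕ) (h : Heis → ℂ) : ℝ :=
  sSup {x : ℝ | ∃ j : ℕ, j ≤ p ∧ ∃ m : Heis, ∃ η : ℝ → ℂ, TestFun δ η ∧ CrNorm q η ≤ 1 ∧
    x = ‖ell Wd δ η m ((VF Vd)^[j] h)‖}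

/-- Integration over `M = Γ_K\ℍ` with respect to the probability measure `ν`
inherited from the Haar measure, computed on the fundamental domain
`[0,1) × [0,1) × [0,1/K)` (rescaled by `K` to have total mass one). -/
def nuInt (K : ℕ) (f : Heis → ℂ) : ℂ :=
  (K : ℂ) * (∫ m in (Set.Icc (0 : ℝ) 1 ×ˢ (Set.Icc (0 : ℝ) 1 ×ˢ Set.Icc (0 : ℝ) (1 / K))), f m)

/-- The setting of the paper: a Heisenberg nilmanifold `M = Γ_K\ℍ`, a partially
hyperbolic automorphism `Φ` with `Φ_* V = λ⁻¹ V`, `Φ_* W = λ W`, `Φ_* Z = Z` for a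
Heisenberg frame `{V, W, Z}`, and a fixed small `δ > 0`. -/
structure NilSetting where
  K : ℕ
  hK : 0 < K
  lam : ℝ
  hlam : 1 < lam
  Vd : ℝ × ℝ × ℝ
  Wd : ℝ × ℝ × ℝ
  frame : hbracket Vd Wd = Zvec
  Φ : Heis → Heis
  Φbij : Function.Bijective Φ
  Φhom : ∀ g g' : Heis, Φ (hmul g g') = hmul (Φ g) (Φ g')
  Φlattice : Φ '' GammaK K = GammaK K
  ΦV : ∀ t : ℝ, Φ (hexp (t • Vd)) = hexp ((lam⁻¹ * t) • Vd)
  ΦW : ∀ t : ℝ, Φ (hexp (t • Wd)) = hexp ((lam * t) • Wd)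
  ΦZ : ∀ t : ℝ, Φ (hexp (t • Zvec)) = hexp (t • Zvec)
  δ : ℝ
  hδ : 0 < δ

namespace NilSetting

/-- The transfer operator `L : h ↦ h ∘ Φ`. -/
def L (S : NilSetting) (h : Heis → ℂ) : Heis → ℂ := fun m => h (S.Φ m)

/-- The space `C^∞_N` as a set of functions. -/
def cn (S : NilSetting) (N : ℤ) : Set (Heis → ℂ) := {h | CN S.K N h}

/-- The anisotropic norm `‖·‖_{p,q}` of the setting. -/
def nrm (S : NilSetting) (p q : ℕ) (h : Heis → ℂ) : ℝ := pqNorm S.Vd S.Wd S.δ p q h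

/-- The seminorm `|·|_{j,q}` of the setting. -/
def snrm (S : NilSetting) (j q : ℕ) (h : Heis → ℂ) : ℝ := semiNorm S.Vd S.Wd S.δ j q h

end NilSetting

/-- `(B, j)` is a realisation of the completion of `Sset` with respect to the
norm `Nrm`: `j` is linear and isometric on `Sset` and has dense image. -/
def IsCompletion (Nrm : (Heis → ℂ) → ℝ) (Sset : Set (Heis → ℂ))
    {B : Type} [NormedAddCommGroup B] [NormedSpace ℂ B] (j : (Heis → ℂ) → B) : Prop :=
  CompleteSpace B ∧
  (∀ h ∈ Sset, ∀ h' ∈ Sset, j (h + h') = j h + j h') ∧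
  (∀ (c : ℂ), ∀ h ∈ Sset, j (c • h) = c • j h) ∧
  (∀ h ∈ Sset, ‖j h‖ = Nrm h) ∧
  Dense (j '' Sset)

/-! ### One-dimensional estimates -/

theorem TestFun.bddAbove_iteratedDeriv {δ : ℝ} {η : ℝ → ℂ} (hη : TestFun δ η) (k : ℕ) :
    BddAbove (Set.range fun t : ℝ => ‖iteratedDeriv k η t‖) := by
  have hc : Continuous (iteratedDeriv k η) :=
    hη.1.continuous_iteratedDeriv k (by exact_mod_cast le_top)
  have hs : HasCompactSupport (iteratedDeriv k η) := by
    refine (hη.2.1.iteratedFDeriv (𝕜 := ℝ) k).mono ?_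
    intro t ht
    rw [Function.mem_support] at ht ⊢
    rwa [← norm_ne_zero_iff, norm_iteratedFDeriv_eq_norm_iteratedDeriv, norm_ne_zero_iff]
  obtain ⟨C, hC⟩ := hs.exists_bound_of_continuous hc
  exact ⟨C, by rintro _ ⟨t, rfl⟩; exact hC t⟩

theorem TestFun.norm_iteratedDeriv_le {δ : ℝ} {q : ℕ} {η : ℝ → ℂ} (hη : TestFun δ η)
    (h1 : CrNorm q η ≤ 1) {k : ℕ} (hk : k ≤ q) (t : ℝ) : ‖iteratedDeriv k η t‖ ≤ 1 := by
  have hle := le_ciSup (f := fun k : Fin (q + 1) =>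
    (2 : ℝ) ^ (q - (k : ℕ)) * ⨆ t : ℝ, ‖iteratedDeriv (k : ℕ) η t‖)
    (Set.finite_range _).bddAbove ⟨k, Nat.lt_succ_of_le hk⟩
  have hle' := hle.trans h1
  have ht := le_ciSup (hη.bddAbove_iteratedDeriv k) t
  have h2 : (1 : ℝ) ≤ 2 ^ (q - k) := one_le_pow₀ (by norm_num)
  have hnn := norm_nonneg (iteratedDeriv k η t)
  simp only at hle' ht
  nlinarith

theorem CrNorm_le_one {q : ℕ} {η : ℝ → ℂ}
    (h : ∀ k ≤ q, ∀ t, ‖iteratedDeriv k η t‖ ≤ ((2 : ℝ) ^ q)⁻¹) : CrNorm q η ≤ 1 := by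
  refine ciSup_le fun k => ?_
  have hk : (k : ℕ) ≤ q := Nat.lt_succ_iff.mp k.2
  calc (2 : ℝ) ^ (q - (k : ℕ)) * ⨆ t : ℝ, ‖iteratedDeriv (k : ℕ) η t‖
      ≤ 2 ^ q * ((2 : ℝ) ^ q)⁻¹ := by
        gcongr
        · exact Real.iSup_nonneg fun t => norm_nonneg _
        · norm_num
        · omega
        · exact ciSup_le fun t => h k hk t
    _ = 1 := mul_inv_cancel₀ (by positivity)

theorem TestFun.eq_zero_of_le_abs {δ : ℝ} {η : ℝ → ℂ} (hη : TestFun δ η) {t : ℝ}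
    (ht : δ ≤ |t|) : η t = 0 := by
  by_contra h
  have := hη.2.2 (subset_tsupport η h)
  exact absurd (abs_lt.mpr this) (not_lt.mpr ht)

theorem TestFun.intervalIntegral_mul {δ : ℝ} {η : ℝ → ℂ} (hη : TestFun δ η) (G : ℝ → ℂ) :
    ∫ t in (-δ)..δ, η t * G t = ∫ t, η t * G t := by
  refine intervalIntegral.integral_eq_integral_of_support_subset fun t ht => ?_
  exact Set.Ioo_subset_Ioc_self (hη.2.2 (subset_tsupport η (left_ne_zero_of_mul ht)))

theorem TestFun.const_mul {δ : ℝ} {η : ℝ → ℂ} (hη : TestFun δ η) (c : ℂ) :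
    TestFun δ fun t => c * η t :=
  ⟨contDiff_const.mul hη.1, hη.2.1.mul_left,
    (tsupport_mul_subset_right (f := fun _ : ℝ => c) (g := η)).trans hη.2.2⟩

theorem exists_testFun_integral_eq_one {δ : ℝ} (hδ : 0 < δ) :
    ∃ ρ : ℝ → ℂ, TestFun δ ρ ∧ ∫ t, ρ t = 1 := by
  let b : ContDiffBump (0 : ℝ) := ⟨δ / 4, δ / 2, by linarith, by linarith⟩
  have hts : tsupport (fun t => ((b.normed volume t : ℝ) : ℂ)) ⊆ Metric.closedBall 0 (δ / 2) := by
    rw [← b.tsupport_normed_eq (μ := volume)]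
    exact closure_mono fun t ht => by simpa using ht
  refine ⟨fun t => (b.normed volume t : ℂ), ⟨?_, ?_, ?_⟩, ?_⟩
  · exact Complex.ofRealCLM.contDiff.comp b.contDiff_normed
  · exact HasCompactSupport.of_support_subset_isCompact (isCompact_closedBall 0 (δ / 2))
      (subset_closure.trans hts)
  · refine hts.trans fun t ht => ?_
    rw [Metric.mem_closedBall, dist_zero_right, Real.norm_eq_abs] at ht
    exact abs_lt.mp (by linarith)
  · rw [integral_complex_ofReal, b.integral_normed, Complex.ofReal_one]

theorem TestFun.exists_iteratedDeriv_bound {δ : ℝ} {ρ : ℝ → ℂ} (hρ : TestFun δ ρ) (q : ℕ) :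
    ∃ R : ℝ, 0 < R ∧ ∀ k ≤ q, ∀ t, ‖iteratedDeriv k ρ t‖ ≤ R := by
  choose C hC using fun k => hρ.bddAbove_iteratedDeriv k
  have hC0 : ∀ k, 0 ≤ C k := fun k => (norm_nonneg _).trans (hC k ⟨0, rfl⟩)
  refine ⟨∑ k ∈ Finset.range (q + 1), C k + 1,
    add_pos_of_nonneg_of_pos (Finset.sum_nonneg fun k _ => hC0 k) one_pos, fun k hk t => ?_⟩
  have := Finset.single_le_sum (f := C) (fun k _ => hC0 k)
    (Finset.mem_range.mpr (Nat.lt_succ_of_le hk))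
  linarith [hC k ⟨t, rfl⟩]

theorem norm_iteratedDeriv_mul_le {q : ℕ} {ρ f : ℝ → ℂ} {R : ℝ}
    (hρ : ContDiff ℝ (⊤ : ℕ∞) ρ) (hf : ContDiff ℝ (⊤ : ℕ∞) f)
    (hR : ∀ k ≤ q, ∀ t, ‖iteratedDeriv k ρ t‖ ≤ R)
    (h1 : ∀ k ≤ q, ∀ t, ‖iteratedDeriv k f t‖ ≤ 1) {k : ℕ} (hk : k ≤ q) (t : ℝ) :
    ‖iteratedDeriv k (ρ * f) t‖ ≤ 2 ^ q * R := by
  have hR0 : 0 ≤ R := (norm_nonneg _).trans (hR 0 (Nat.zero_le _) 0)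
  rw [iteratedDeriv_mul (hρ.of_le (by exact_mod_cast le_top)).contDiffAt
    (hf.of_le (by exact_mod_cast le_top)).contDiffAt]
  calc _ ≤ ∑ i ∈ Finset.range (k + 1), (k.choose i : ℝ) * R := by
        refine norm_sum_le_of_le _ fun i hi => ?_
        have hi' : i ≤ k := Nat.lt_succ_iff.mp (Finset.mem_range.mp hi)
        rw [norm_mul, norm_mul, Complex.norm_natCast]
        calc _ ≤ (k.choose i : ℝ) * R * 1 := by
              gcongr
              · exact hR i (hi'.trans hk) t
              · exact h1 _ ((Nat.sub_le _ _).trans hk) t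
          _ = _ := mul_one _
    _ = 2 ^ k * R := by
        rw [← Finset.sum_mul]
        congr 1
        exact_mod_cast Nat.sum_range_choose k
    _ ≤ 2 ^ q * R := by
        gcongr
        norm_num

/-- Averaging the translates of a compactly supported function against a unit mass. -/
theorem integral_integral_mul_comp_add {ρ k : ℝ → ℂ} (hρ : Integrable ρ) (hk : Integrable k)
    (h1 : ∫ t, ρ t = 1) : ∫ u, ∫ s, ρ s * k (s + u) = ∫ s, k s := by
  have h := integral_convolution (μ := (volume : Measure ℝ)) (ν := volume)
    (ContinuousLinearMap.mul ℝ ℂ) hρ.comp_neg hk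
  rw [ContinuousLinearMap.mul_apply', integral_neg_eq_self (f := ρ), h1, one_mul] at h
  rw [← h]
  refine integral_congr_ae (Eventually.of_forall fun u => ?_)
  simp only [convolution, ContinuousLinearMap.mul_apply']
  rw [← integral_neg_eq_self]
  simp [add_comm, sub_eq_add_neg]

/-- Averages of a function along a dilated window are controlled by its averages along translates
of the original window, uniformly in the dilation. -/
theorem exists_dilation_bound {δ : ℝ} (hδ : 0 < δ) (q : ℕ) :
    ∃ C : ℝ, 0 ≤ C ∧ ∀ (G : ℝ → ℂ) (A μ : ℝ), Continuous G → 1 ≤ μ →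
      (∀ (u : ℝ) (η : ℝ → ℂ), TestFun δ η → CrNorm q η ≤ 1 →
        ‖∫ t in (-δ)..δ, η t * G (t + u)‖ ≤ A) →
      ∀ η : ℝ → ℂ, TestFun δ η → CrNorm q η ≤ 1 →
        ‖∫ t in (-δ)..δ, η t * G (μ * t)‖ ≤ C * A := by
  obtain ⟨ρ, hρ, hρ1⟩ := exists_testFun_integral_eq_one hδ
  obtain ⟨R, hR0, hR⟩ := hρ.exists_iteratedDeriv_bound q
  set C₀ : ℝ := 2 ^ q * (2 ^ q * R) with hC₀
  have hC₀p : 0 < C₀ := by positivity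
  refine ⟨C₀ * (4 * δ), by positivity, fun G A μ hG hμ hA η hη hη1 => ?_⟩
  have hμ0 : 0 < μ := by linarith
  set f : ℝ → ℂ := fun s => η (μ⁻¹ * s) with hf
  have hfs : ContDiff ℝ (⊤ : ℕ∞) f := hη.1.comp (contDiff_const.mul contDiff_id)
  have hf0 : ∀ s, μ * δ ≤ |s| → f s = 0 := fun s hs => hη.eq_zero_of_le_abs (by
    rw [abs_mul, abs_of_pos (inv_pos.mpr hμ0), le_inv_mul_iff₀ hμ0]
    exact hs)
  have hfd : ∀ k ≤ q, ∀ t, ‖iteratedDeriv k f t‖ ≤ 1 := fun k hk t => by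
    rw [hf, iteratedDeriv_comp_const_smul (hη.1.of_le (by exact_mod_cast le_top)), norm_smul,
      norm_pow, Real.norm_eq_abs, abs_of_pos (inv_pos.mpr hμ0)]
    exact mul_le_one₀ (pow_le_one₀ (inv_pos.mpr hμ0).le (inv_le_one_of_one_le₀ hμ))
      (norm_nonneg _) (hη.norm_iteratedDeriv_le hη1 hk _)
  have hk_cont : Continuous fun s => f s * G s := hfs.continuous.mul hG
  have hk_supp : HasCompactSupport fun s => f s * G s := by
    refine HasCompactSupport.of_support_subset_isCompact (isCompact_Icc (a := -(μ * δ))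
      (b := μ * δ)) fun s hs => ?_
    by_contra hcon
    refine left_ne_zero_of_mul hs (hf0 s ?_)
    rw [Set.mem_Icc, ← abs_le] at hcon
    exact (not_le.mp hcon).le
  have hwin : ∀ u, ‖∫ s, ρ s * (f (s + u) * G (s + u))‖ ≤ C₀ * A := fun u => by
    have hfu : ContDiff ℝ (⊤ : ℕ∞) fun s => f (s + u) := hfs.comp (contDiff_id.add contDiff_const)
    have hT : TestFun δ (ρ * fun s => f (s + u)) :=
      ⟨hρ.1.mul hfu, hρ.2.1.mul_right, (tsupport_mul_subset_left).trans hρ.2.2⟩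
    have hcr : CrNorm q (fun s => ((C₀⁻¹ : ℝ) : ℂ) * (ρ * fun s => f (s + u)) s) ≤ 1 := by
      refine CrNorm_le_one fun k hk t => ?_
      rw [iteratedDeriv_const_mul_field, norm_mul, Complex.norm_real, Real.norm_eq_abs,
        abs_of_pos (inv_pos.mpr hC₀p)]
      have hb := norm_iteratedDeriv_mul_le hρ.1 hfu hR (fun k hk t => by
        rw [iteratedDeriv_comp_add_const]; exact hfd k hk _) hk t
      calc _ ≤ C₀⁻¹ * (2 ^ q * R) := by gcongr
        _ = _ := by rw [hC₀]; field_simp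
    have h := hA u _ (hT.const_mul _) hcr
    rw [(hT.const_mul _).intervalIntegral_mul fun t => G (t + u)] at h
    simp only [Pi.mul_apply, mul_assoc] at h
    rw [integral_const_mul, norm_mul, Complex.norm_real, Real.norm_eq_abs,
        abs_of_pos (inv_pos.mpr hC₀p), inv_mul_le_iff₀ hC₀p] at h
    exact h
  have hwin0 : ∀ u, u ∉ Set.Icc (-((μ + 1) * δ)) ((μ + 1) * δ) →
      ∫ s, ρ s * (f (s + u) * G (s + u)) = 0 := fun u hu => by
    rw [Set.mem_Icc, ← abs_le, not_le] at hu
    refine integral_eq_zero_of_ae (Eventually.of_forall fun s => ?_)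
    rcases le_or_gt δ |s| with hs | hs
    · simp [hρ.eq_zero_of_le_abs hs]
    · have h3 : |u| ≤ |s + u| + |s| := by
        simpa using abs_sub (s + u) s
      simp [hf0 (s + u) (by linarith)]
  have htot : ‖∫ s, f s * G s‖ ≤ C₀ * A * (2 * ((μ + 1) * δ)) := by
    rw [← integral_integral_mul_comp_add (hρ.1.continuous.integrable_of_hasCompactSupport hρ.2.1)
      (hk_cont.integrable_of_hasCompactSupport hk_supp) hρ1,
      ← setIntegral_eq_integral_of_forall_compl_eq_zero hwin0]
    refine (norm_setIntegral_le_of_norm_le_const (by simp) fun u _ => hwin u).trans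
      (le_of_eq ?_)
    rw [Real.volume_real_Icc_of_le (by nlinarith)]
    ring
  have hscale : ∫ t in (-δ)..δ, η t * G (μ * t) = (μ⁻¹ : ℝ) • ∫ s, f s * G s := by
    rw [hη.intervalIntegral_mul fun t => G (μ * t)]
    have h := Measure.integral_comp_mul_left (fun s => f s * G s) μ
    rw [abs_of_pos (inv_pos.mpr hμ0)] at h
    rw [← h]
    simp [hf, inv_mul_cancel_left₀ hμ0.ne']
  have hA0 : 0 ≤ C₀ * A := (norm_nonneg _).trans (hwin 0)
  rw [hscale, norm_smul, Real.norm_eq_abs, abs_of_pos (inv_pos.mpr hμ0), inv_mul_le_iff₀ hμ0]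
  nlinarith [mul_nonneg hA0 hδ.le, mul_nonneg (mul_nonneg hA0 hδ.le) (sub_nonneg.mpr hμ)]

/-! ### Left-invariant vector fields on the nilmanifold -/

theorem hmul_assoc (a b c : Heis) : hmul (hmul a b) c = hmul a (hmul b c) := by
  ext <;> simp only [hmul] <;> ring

theorem hflow_hmul (U : ℝ × ℝ × ℝ) (t : ℝ) (g m : Heis) :
    hflow U t (hmul g m) = hmul g (hflow U t m) :=
  hmul_assoc _ _ _

theorem hflow_hflow (U : ℝ × ℝ × ℝ) (t u : ℝ) (m : Heis) :
    hflow U t (hflow U u m) = hflow U (t + u) m := by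
  ext <;> simp [hflow, hmul, hexp] <;> ring

theorem hflow_zero (U : ℝ × ℝ × ℝ) (m : Heis) : hflow U 0 m = m := by
  ext <;> simp [hflow, hmul, hexp]

theorem continuous_hflow (U : ℝ × ℝ × ℝ) (m : Heis) : Continuous fun t => hflow U t m := by
  simp only [hflow, hmul, hexp, Prod.smul_fst, Prod.smul_snd, smul_eq_mul]
  fun_prop

theorem hasDerivAt_hflow (U : ℝ × ℝ × ℝ) (m : Heis) :
    HasDerivAt (fun t => hflow U t m) ((U.1, U.2.1, U.2.2 + m.1 * U.2.1) : Heis) 0 := by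
  simp only [hflow, hmul, hexp, Prod.smul_fst, Prod.smul_snd, smul_eq_mul]
  have h (a : ℝ) : HasDerivAt (fun t : ℝ => t * a) a 0 := by
    simpa using (hasDerivAt_id (0 : ℝ)).mul_const a
  refine ((h _).const_add _).prodMk (((h _).const_add _).prodMk ?_)
  have h3 := (((h U.2.2).add (((h U.1).mul (h U.2.1)).div_const 2)).const_add m.2.2).add
    ((h U.2.1).const_mul m.1)
  exact h3.congr_deriv (by simp)

theorem VF_eq_fderiv (U : ℝ × ℝ × ℝ) {h : Heis → ℂ} (hh : Differentiable ℝ h) (m : Heis) :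
    VF U h m = fderiv ℝ h m (U.1, U.2.1, U.2.2 + m.1 * U.2.1) := by
  have h0 := (hh (hflow U 0 m)).hasFDerivAt.comp_hasDerivAt (0 : ℝ) (hasDerivAt_hflow U m)
  rw [hflow_zero] at h0
  exact h0.deriv

theorem contDiff_VF (U : ℝ × ℝ × ℝ) {h : Heis → ℂ} (hh : ContDiff ℝ (⊤ : ℕ∞) h) :
    ContDiff ℝ (⊤ : ℕ∞) (VF U h) := by
  rw [funext (VF_eq_fderiv U (hh.differentiable (by simp)))]
  exact (hh.fderiv_right (m := (⊤ : ℕ∞)) (by exact_mod_cast le_top)).clm_apply (by fun_prop)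

theorem SmoothM.VF {K : ℕ} {h : Heis → ℂ} (hh : SmoothM K h) (U : ℝ × ℝ × ℝ) :
    SmoothM K (VF U h) :=
  ⟨contDiff_VF U hh.1, fun γ hγ m => by
    simp only [_root_.VF, hflow_hmul, hh.2 γ hγ]⟩

theorem SmoothM.iterate_VF {K : ℕ} {h : Heis → ℂ} (hh : SmoothM K h) (U : ℝ × ℝ × ℝ) (n : ℕ) :
    SmoothM K ((_root_.VF U)^[n] h) := by
  induction n with
  | zero => exact hh
  | succ n ih => rw [Function.iterate_succ_apply']; exact ih.VF U

theorem SmoothM.exists_bound {K : ℕ} (hK : 0 < K) {h : Heis → ℂ} (hh : SmoothM K h) :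
    ∃ C : ℝ, ∀ m, ‖h m‖ ≤ C := by
  have hcpt : IsCompact (Set.Icc (0 : ℝ) 1 ×ˢ (Set.Icc (0 : ℝ) 1 ×ˢ Set.Icc (0 : ℝ) 1)) :=
    isCompact_Icc.prod (isCompact_Icc.prod isCompact_Icc)
  obtain ⟨C, hC⟩ := hcpt.exists_bound_of_continuousOn hh.1.continuous.continuousOn
  refine ⟨C, fun ⟨x, y, z⟩ => ?_⟩
  have hK1 : (1 : ℝ) ≤ K := by exact_mod_cast hK
  have hK0 : (0 : ℝ) < K := by linarith
  have hz : z + -⌊x⌋ * y + (-⌊(K : ℝ) * (z + -⌊x⌋ * y)⌋) / K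
      = Int.fract ((K : ℝ) * (z + -⌊x⌋ * y)) / K := by
    rw [Int.fract]
    field_simp
    ring
  have hγ : (((-⌊x⌋ : ℤ) : ℝ), ((-⌊y⌋ : ℤ) : ℝ),
      ((-⌊(K : ℝ) * (z + -⌊x⌋ * y)⌋ : ℤ) : ℝ) / K) ∈ GammaK K := ⟨_, _, _, rfl⟩
  rw [← hh.2 _ hγ]
  refine hC _ ⟨?_, ?_, ?_⟩
  · have h1 := Int.fract_nonneg x
    have h2 := (Int.fract_lt_one x).le
    rw [Int.fract] at h1 h2
    simp only [hmul, Int.cast_neg]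
    constructor <;> linarith
  · have h1 := Int.fract_nonneg y
    have h2 := (Int.fract_lt_one y).le
    rw [Int.fract] at h1 h2
    simp only [hmul, Int.cast_neg]
    constructor <;> linarith
  · have h1 := Int.fract_nonneg ((K : ℝ) * (z + -⌊x⌋ * y))
    have h2 := (Int.fract_lt_one ((K : ℝ) * (z + -⌊x⌋ * y))).le
    have h3 : Int.fract ((K : ℝ) * (z + -⌊x⌋ * y)) / K ≤ 1 := by
      rw [div_le_one hK0]; linarith
    have h4 : 0 ≤ Int.fract ((K : ℝ) * (z + -⌊x⌋ * y)) / K := by positivity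
    rw [← hz] at h3 h4
    simp only [hmul, Int.cast_neg]
    constructor <;> linarith

theorem bddAbove_pqNorm {K : ℕ} (hK : 0 < K) (Vd Wd : ℝ × ℝ × ℝ) {δ : ℝ} (hδ : 0 < δ) (p q : ℕ)
    {h : Heis → ℂ} (hh : SmoothM K h) :
    BddAbove {x : ℝ | ∃ j : ℕ, j ≤ p ∧ ∃ m : Heis, ∃ η : ℝ → ℂ, TestFun δ η ∧ CrNorm q η ≤ 1 ∧
      x = ‖ell Wd δ η m ((VF Vd)^[j] h)‖} := by
  choose C hC using fun j => (hh.iterate_VF Vd j).exists_bound hK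
  have hC0 : ∀ j, 0 ≤ C j := fun j => (norm_nonneg _).trans (hC j 0)
  refine ⟨(∑ j ∈ Finset.range (p + 1), C j) * (2 * δ), ?_⟩
  rintro _ ⟨j, hj, m, η, hη, hη1, rfl⟩
  have hb := intervalIntegral.norm_integral_le_of_norm_le_const (a := -δ) (b := δ) (C := C j)
    (f := fun t => η t * (VF Vd)^[j] h (hflow Wd t m)) fun t _ => by
      rw [norm_mul]
      have h1 := hη.norm_iteratedDeriv_le hη1 (Nat.zero_le q) t
      rw [iteratedDeriv_zero] at h1
      calc _ ≤ 1 * C j := by gcongr; exact hC j _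
        _ = C j := one_mul _
  have hs := Finset.single_le_sum (f := C) (fun k _ => hC0 k)
    (Finset.mem_range.mpr (Nat.lt_succ_of_le hj))
  rw [sub_neg_eq_add, ← two_mul, abs_of_pos (by linarith)] at hb
  exact hb.trans (by gcongr)

theorem pqNorm_nonneg (Vd Wd : ℝ × ℝ × ℝ) (δ : ℝ) (p q : ℕ) (h : Heis → ℂ) :
    0 ≤ pqNorm Vd Wd δ p q h :=
  Real.sSup_nonneg (by rintro _ ⟨j, -, m, η, -, -, rfl⟩; exact norm_nonneg _)

/-! ### Dilating automorphisms -/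

/-- `Ψ` is an endomorphism of `ℍ` preserving `Γ_K` which contracts `Vd` and expands `Wd` by the
factor `μ` and fixes the centre. -/
structure IsDilation (K : ℕ) (Vd Wd : ℝ × ℝ × ℝ) (μ : ℝ) (Ψ : Heis → Heis) : Prop where
  hom : ∀ g g' : Heis, Ψ (hmul g g') = hmul (Ψ g) (Ψ g')
  lattice : ∀ γ ∈ GammaK K, Ψ γ ∈ GammaK K
  V : ∀ t : ℝ, Ψ (hexp (t • Vd)) = hexp ((μ⁻¹ * t) • Vd)
  W : ∀ t : ℝ, Ψ (hexp (t • Wd)) = hexp ((μ * t) • Wd)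
  Z : ∀ t : ℝ, Ψ (hexp (t • Zvec)) = hexp (t • Zvec)

theorem NilSetting.isDilation (S : NilSetting) : IsDilation S.K S.Vd S.Wd S.lam S.Φ :=
  ⟨S.Φhom, fun _ hγ => S.Φlattice ▸ Set.mem_image_of_mem _ hγ, S.ΦV, S.ΦW, S.ΦZ⟩

section Dilation

variable {K : ℕ} {Vd Wd : ℝ × ℝ × ℝ} {μ : ℝ} {Ψ : Heis → Heis}

theorem IsDilation.iterate (hΨ : IsDilation K Vd Wd μ Ψ) (n : ℕ) :
    IsDilation K Vd Wd (μ ^ n) Ψ^[n] := by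
  induction n with
  | zero => exact ⟨by simp, by simp, by simp, by simp, by simp⟩
  | succ n ih =>
    refine ⟨fun g g' => ?_, fun γ hγ => ?_, fun t => ?_, fun t => ?_, fun t => ?_⟩ <;>
      rw [Function.iterate_succ_apply']
    · rw [ih.hom, hΨ.hom, Function.iterate_succ_apply', Function.iterate_succ_apply']
    · exact hΨ.lattice _ (ih.lattice γ hγ)
    · rw [ih.V, hΨ.V, pow_succ', mul_inv, mul_assoc]
    · rw [ih.W, hΨ.W, pow_succ', mul_assoc]
    · rw [ih.Z, hΨ.Z]

theorem IsDilation.contDiff (hΨ : IsDilation K Vd Wd μ Ψ) (hVW : hbracket Vd Wd = Zvec) :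
    ContDiff ℝ (⊤ : ℕ∞) Ψ := by
  have hdet : Vd.1 * Wd.2.1 - Wd.1 * Vd.2.1 = 1 := congrArg (fun v : ℝ × ℝ × ℝ => v.2.2) hVW
  let a : Heis → ℝ := fun m => m.1 * Wd.2.1 - m.2.1 * Wd.1
  let b : Heis → ℝ := fun m => m.2.1 * Vd.1 - m.1 * Vd.2.1
  let c : Heis → ℝ := fun m => m.2.2 - (hmul (hexp (a m • Vd)) (hexp (b m • Wd))).2.2
  have hdec (m : Heis) :
      m = hmul (hmul (hexp (a m • Vd)) (hexp (b m • Wd))) (hexp (c m • Zvec)) := by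
    ext
    · simp [hmul, hexp, Zvec, a, b]
      linear_combination (-m.1) * hdet
    · simp [hmul, hexp, Zvec, a, b]
      linear_combination (-m.2.1) * hdet
    · simp [hmul, hexp, Zvec, c]
  have hΨm : Ψ = fun m => hmul (hmul (hexp ((μ⁻¹ * a m) • Vd)) (hexp ((μ * b m) • Wd)))
      (hexp (c m • Zvec)) := by
    funext m
    conv_lhs => rw [hdec m]
    rw [hΨ.hom, hΨ.hom, hΨ.V, hΨ.W, hΨ.Z]
  rw [hΨm]
  simp only [hmul, hexp, Zvec, a, b, c, Prod.smul_fst, Prod.smul_snd, smul_eq_mul]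
  fun_prop

theorem SmoothM.comp_isDilation {h : Heis → ℂ} (hh : SmoothM K h)
    (hΨ : IsDilation K Vd Wd μ Ψ) (hVW : hbracket Vd Wd = Zvec) :
    SmoothM K fun m => h (Ψ m) :=
  ⟨hh.1.comp (hΨ.contDiff hVW), fun γ hγ m => by
    simp only [hΨ.hom]; exact hh.2 _ (hΨ.lattice γ hγ) _⟩

theorem VF_comp {U : ℝ × ℝ × ℝ} {c : ℝ} (hom : ∀ g g' : Heis, Ψ (hmul g g') = hmul (Ψ g) (Ψ g'))
    (hU : ∀ t : ℝ, Ψ (hexp (t • U)) = hexp ((c * t) • U)) (h : Heis → ℂ) :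
    (VF U fun m => h (Ψ m)) = fun m => (c : ℂ) * VF U h (Ψ m) := by
  funext m
  simp only [VF, hflow, hom, hU]
  rw [deriv_comp_mul_left c fun t => h (hmul (Ψ m) (hexp (t • U))), mul_zero, Complex.real_smul]

theorem IsDilation.iterate_VF_comp (hΨ : IsDilation K Vd Wd μ Ψ) (h : Heis → ℂ) (n : ℕ) :
    ((VF Vd)^[n] fun m => h (Ψ m)) = fun m => ((μ⁻¹ : ℝ) : ℂ) ^ n * (VF Vd)^[n] h (Ψ m) := by
  induction n generalizing h with
  | zero => simp
  | succ n ih =>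
    have hmulc : ∀ (c : ℂ) (f : Heis → ℂ), (VF Vd fun m => c * f m) = fun m => c * VF Vd f m :=
      fun c f => funext fun m => deriv_const_mul_field c
    rw [Function.iterate_succ_apply', ih, hmulc, VF_comp hΨ.hom hΨ.V, Function.iterate_succ_apply']
    funext m
    ring

theorem CN.comp_isDilation {N : ℤ} {h : Heis → ℂ} (hh : CN K N h)
    (hΨ : IsDilation K Vd Wd μ Ψ) (hVW : hbracket Vd Wd = Zvec) :
    CN K N fun m => h (Ψ m) := by
  refine ⟨hh.1.comp_isDilation hΨ hVW, ?_⟩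
  rw [VF_comp (c := 1) hΨ.hom (by simpa using hΨ.Z), hh.2]
  simp

/-- The anisotropic norm is bounded under composition with dilations, uniformly in the factor. -/
theorem exists_pqNorm_comp_le {δ : ℝ} (hδ : 0 < δ) (hK : 0 < K) (Vd Wd : ℝ × ℝ × ℝ) (p q : ℕ) :
    ∃ C : ℝ, 0 ≤ C ∧ ∀ (μ : ℝ) (Ψ : Heis → Heis), 1 ≤ μ → IsDilation K Vd Wd μ Ψ →
      ∀ h, SmoothM K h →
        pqNorm Vd Wd δ p q (fun m => h (Ψ m)) ≤ C * pqNorm Vd Wd δ p q h := by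
  obtain ⟨C, hC0, hC⟩ := exists_dilation_bound hδ q
  refine ⟨C, hC0, fun μ Ψ hμ hΨ h hh => ?_⟩
  refine Real.sSup_le ?_ (mul_nonneg hC0 (pqNorm_nonneg _ _ _ _ _ _))
  rintro _ ⟨j, hj, m, η, hη, hη1, rfl⟩
  set g := (VF Vd)^[j] h
  have hg : Continuous g := (hh.iterate_VF Vd j).1.continuous
  have hflowΨ (t : ℝ) : Ψ (hflow Wd t m) = hflow Wd (μ * t) (Ψ m) := by
    rw [hflow, hΨ.hom, hΨ.W, hflow]
  have hmain : ‖∫ t in (-δ)..δ, η t * g (hflow Wd (μ * t) (Ψ m))‖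
      ≤ C * pqNorm Vd Wd δ p q h := by
    refine hC (fun s => g (hflow Wd s (Ψ m))) _ μ (hg.comp (continuous_hflow _ _)) hμ ?_ η hη hη1
    intro u η' hη' hη1'
    refine le_csSup (bddAbove_pqNorm hK Vd Wd hδ p q hh)
      ⟨j, hj, hflow Wd u (Ψ m), η', hη', hη1', ?_⟩
    simp only [ell, hflow_hflow, g]
  have hell : ell Wd δ η m ((VF Vd)^[j] fun m => h (Ψ m)) = ((μ⁻¹ : ℝ) : ℂ) ^ j *
      ∫ t in (-δ)..δ, η t * g (hflow Wd (μ * t) (Ψ m)) := by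
    rw [hΨ.iterate_VF_comp, ell, ← intervalIntegral.integral_const_mul]
    refine intervalIntegral.integral_congr fun t _ => ?_
    simp only [hflowΨ, g]
    ring
  have hμ0 : 0 < μ⁻¹ := inv_pos.mpr (by linarith)
  rw [hell, norm_mul, norm_pow, Complex.norm_real, Real.norm_eq_abs, abs_of_pos hμ0]
  exact (mul_le_of_le_one_left (norm_nonneg _)
    (pow_le_one₀ hμ0.le (inv_le_one_of_one_le₀ hμ))).trans hmain

end Dilation

theorem pqNorm_one_pos {δ : ℝ} (hδ : 0 < δ) (Vd Wd : ℝ × ℝ × ℝ) (p q : ℕ) :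
    0 < pqNorm Vd Wd δ p q fun _ => 1 := by
  obtain ⟨ρ, hρ, hρ1⟩ := exists_testFun_integral_eq_one hδ
  obtain ⟨R, hR0, hR⟩ := hρ.exists_iteratedDeriv_bound q
  have hsm : SmoothM 1 fun _ => (1 : ℂ) := ⟨contDiff_const, fun _ _ _ => rfl⟩
  have hc : (0 : ℝ) < (2 ^ q * R)⁻¹ := by positivity
  refine hc.trans_le (le_csSup (bddAbove_pqNorm one_pos Vd Wd hδ p q hsm)
    ⟨0, Nat.zero_le _, 0, fun t => (((2 ^ q * R)⁻¹ : ℝ) : ℂ) * ρ t, hρ.const_mul _, ?_, ?_⟩)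
  · refine CrNorm_le_one fun k hk t => ?_
    rw [iteratedDeriv_const_mul_field, norm_mul, Complex.norm_real, Real.norm_eq_abs,
      abs_of_pos hc]
    calc _ ≤ (2 ^ q * R)⁻¹ * R := by gcongr; exact hR k hk t
      _ = _ := by field_simp
  · rw [ell, Function.iterate_zero_apply, (hρ.const_mul _).intervalIntegral_mul fun _ => 1]
    simp only [mul_one]
    rw [integral_const_mul, hρ1, mul_one, Complex.norm_real, Real.norm_eq_abs, abs_of_pos hc]

/-- The space `C^∞_N` as a linear subspace. -/
def cnSubmodule (K : ℕ) (N : ℤ) : Submodule ℂ (Heis → ℂ) where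
  carrier := {h | CN K N h}
  zero_mem' := ⟨⟨contDiff_const, fun _ _ _ => rfl⟩, by funext m; simp [VF]⟩
  add_mem' := by
    rintro f g ⟨hf, hf'⟩ ⟨hg, hg'⟩
    refine ⟨⟨hf.1.add hg.1, fun γ hγ m => ?_⟩, ?_⟩
    · simp only [Pi.add_apply, hf.2 γ hγ, hg.2 γ hγ]
    · funext m
      have hfd := hf.1.differentiable (by simp)
      have hgd := hg.1.differentiable (by simp)
      have hfm := congrFun hf' m
      have hgm := congrFun hg' m
      rw [VF_eq_fderiv _ hfd] at hfm
      rw [VF_eq_fderiv _ hgd] at hgm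
      rw [VF_eq_fderiv _ (hfd.add hgd), fderiv_add (hfd m) (hgd m), add_apply,
        hfm, hgm, Pi.add_apply, mul_add]
  smul_mem' := by
    rintro c f ⟨hf, hf'⟩
    refine ⟨⟨contDiff_const.smul hf.1, fun γ hγ m => ?_⟩, ?_⟩
    · simp only [Pi.smul_apply, hf.2 γ hγ]
    · funext m
      have h1 : VF Zvec (c • f) m = c * VF Zvec f m := deriv_const_mul_field c
      rw [h1, hf', Pi.smul_apply, smul_eq_mul]
      ring

/-! ### Spectral radius -/

/-- A power-bounded element of a Banach algebra has spectral radius at most one. -/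
theorem spectralRadius_le_one_of_norm_pow_le {A : Type*} [NormedRing A] [NormedAlgebra ℂ A]
    [CompleteSpace A] {a : A} {C : ℝ} (h : ∀ n : ℕ, ‖a ^ n‖ ≤ C) : spectralRadius ℂ a ≤ 1 := by
  refine iSup₂_le fun k hk => ?_
  have hle : ∀ n : ℕ, ‖k‖ ^ n ≤ C * ‖(1 : A)‖ := fun n => by
    rw [← norm_pow]
    exact (spectrum.norm_le_norm_mul_of_mem (spectrum.pow_mem_pow a n hk)).trans (by
      gcongr; exact h n)
  have hk1 : ‖k‖ ≤ 1 := by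
    by_contra! hlt
    obtain ⟨n, hn⟩ := pow_unbounded_of_one_lt (C * ‖(1 : A)‖) hlt
    exact (hn.trans_le (hle n)).false
  exact_mod_cast hk1

/-- **Lemma 3.4.** The transfer operator `L` extends to a continuous linear operator
on `B^{p,q}_N` with spectral radius at most one; for `N = 0` the spectral radius of
`L : B^{p,q}_0 → B^{p,q}_0` is exactly `1`. -/
theorem cont_op (S : NilSetting) (N : ℤ) (p q : ℕ) (hq : 1 ≤ q)
    (B : Type) [NormedAddCommGroup B] [NormedSpace ℂ B] (j : (Heis → ℂ) → B)
    (hB : IsCompletion (S.nrm p q) (S.cn N) j) :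
    ∃ Lb : B →L[ℂ] B,
      (∀ h ∈ S.cn N, Lb (j h) = j (S.L h)) ∧
      spectralRadius ℂ Lb ≤ 1 ∧
      (N = 0 → spectralRadius ℂ Lb = 1) := by
  obtain ⟨hBc, hadd, hsmul, hnorm, hdense⟩ := hB
  obtain ⟨C, hC0, hC⟩ := exists_pqNorm_comp_le S.hδ S.hK S.Vd S.Wd p q
  let E := cnSubmodule S.K N
  let e : E →ₗ[ℂ] B :=
    { toFun := fun h => j h
      map_add' := fun h h' => hadd h h.2 h' h'.2
      map_smul' := fun c h => hsmul c h h.2 }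
  have hL : ∀ h ∈ S.cn N, S.L h ∈ S.cn N := fun h (hh : CN S.K N h) =>
    hh.comp_isDilation S.isDilation S.frame
  let f : E →ₗ[ℂ] B :=
    { toFun := fun h => j (S.L h)
      map_add' := fun h h' => hadd _ (hL h h.2) _ (hL h' h'.2)
      map_smul' := fun c h => hsmul c _ (hL h h.2) }
  have hed : DenseRange e := by
    refine hdense.mono ?_
    rintro _ ⟨h, hh, rfl⟩
    exact ⟨⟨h, hh⟩, rfl⟩
  have hbound : ∀ x, ‖f x‖ ≤ C * ‖e x‖ := fun x => by
    change ‖j (S.L x)‖ ≤ C * ‖j x‖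
    rw [hnorm _ (hL x x.2), hnorm _ x.2]
    exact hC S.lam S.Φ S.hlam.le S.isDilation x x.2.1
  let T : B →L[ℂ] B := f.extendOfNorm e
  have hT : ∀ h ∈ S.cn N, T (j h) = j (S.L h) := fun h hh =>
    LinearMap.extendOfNorm_eq hed ⟨C, hbound⟩ ⟨h, hh⟩
  have hTn : ∀ (n : ℕ), ∀ h ∈ S.cn N,
      (fun m => h (S.Φ^[n] m)) ∈ S.cn N ∧ (T ^ n) (j h) = j fun m => h (S.Φ^[n] m) := by
    intro n
    induction n with
    | zero => exact fun h hh => ⟨hh, rfl⟩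
    | succ n ih =>
      intro h hh
      obtain ⟨h1, h2⟩ := ih (S.L h) (hL h hh)
      simp only [Function.iterate_succ_apply']
      refine ⟨h1, ?_⟩
      rw [pow_succ, mul_apply_eq_comp, hT h hh, h2]
      rfl
  refine ⟨T, hT, ?_⟩
  have hle : spectralRadius ℂ T ≤ 1 := by
    refine spectralRadius_le_one_of_norm_pow_le (C := C) fun n => ?_
    refine ContinuousLinearMap.opNorm_le_bound _ hC0 fun x => ?_
    refine hdense.induction ?_ (isClosed_le (by fun_prop) (by fun_prop)) x
    rintro _ ⟨h, hh, rfl⟩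
    obtain ⟨h1, h2⟩ := hTn n h hh
    rw [h2, hnorm _ h1, hnorm _ hh]
    exact hC _ _ (one_le_pow₀ S.hlam.le) (S.isDilation.iterate n) h hh.1
  refine ⟨hle, ?_⟩
  rintro rfl
  refine le_antisymm hle ?_
  have hone : (fun _ => 1 : Heis → ℂ) ∈ S.cn 0 :=
    ⟨⟨contDiff_const, fun _ _ _ => rfl⟩, by funext m; simp [VF]⟩
  have hfix : T (j fun _ => 1) = j fun _ => 1 := hT _ hone
  have hne : (j fun _ => 1) ≠ 0 := by
    rw [← norm_pos_iff, hnorm _ hone]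
    exact pqNorm_one_pos S.hδ S.Vd S.Wd p q
  have hmem : (1 : ℂ) ∈ spectrum ℂ T := by
    intro hu
    have hinj := ((ContinuousLinearMap.isUnit_iff_bijective).mp hu).1
    refine hne (hinj ?_)
    simp [hfix]
  refine le_trans ?_ (le_iSup₂ (f := fun (k : ℂ) (_ : k ∈ spectrum ℂ T) => (‖k‖₊ : ENNReal)) 1 hmem)
  simp
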